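/- For every constant ε>0 there exists a constant c>1 such that for every s>0 and every n∈ℕ there exists a function SpExt : {0,1}^n → {0,1} with the following property: for every space-s source X on n bits with min-entropy H∞(X) ≥ 2s + c·log₂ n, the distribution of SpExt(X) is ε-close in statistical distance to the uniform distribution on {0,1}. (Explicitness/efficient computability is omitted; only existence is asserted.) -/

import Mathlib

/-- `Bits n` is the set of `n`-bit strings `{0,1}^n`. -/
abbrev Bits (n : ℕ) : Type := Fin n → Bool

/-- Statistical distance `Δ(p,q) = max_{T ⊆ S} |p(T) - q(T)|`. -/
noncomputable def sd {α : Type*} [Fintype α] (p q : PMF α) : ℝ :=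
  ⨆ T : Finset α, |∑ x ∈ T, (p x).toReal - ∑ x ∈ T, (q x).toReal|

/-- `X` has min-entropy at least `k`, i.e. `Pr[X = x] ≤ 2^{-k}` for all `x`. -/
def minEntropyGe {α : Type*} (p : PMF α) (k : ℝ) : Prop :=
  ∀ x, (p x).toReal ≤ (2 : ℝ) ^ (-k)

/-- The uniform distribution on one bit. -/
noncomputable def uniformBit : PMF Bool := PMF.uniformOfFintype Bool

/-- Run a branching program with (time-dependent) randomized transitions `trans`
from state `st`, starting at time `t`, for `m` steps; outputs the emitted bits. -/
noncomputable def bpRun {S : Type*} (trans : ℕ → S → PMF (Bool × S)) :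
    ℕ → ℕ → S → PMF (List Bool)
  | _, 0, _ => PMF.pure []
  | t, m + 1, st =>
      (trans t st).bind fun bs => (bpRun trans (t + 1) m bs.2).map fun l => bs.1 :: l

/-- A space-`s` source on `n` bits: generated by taking a random walk on a
branching program of length `n` and width `2^s` (i.e. at most `2^s` states),
emitting one bit per step. -/
def IsSpaceSource {n : ℕ} (s : ℕ) (p : PMF (Bits n)) : Prop :=
  ∃ (S : Type) (inst : Fintype S) (start : S) (trans : ℕ → S → PMF (Bool × S)),
    @Fintype.card S inst ≤ 2 ^ s ∧
    p = (bpRun trans 0 n start).map fun l => fun i : Fin n => l.getD i.val false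

/-- The weight assigned to the string `x` by the walks of length `m` that start in the state `st`
at time `t`, where a step at time `t` from `st` has weight `a t st (bit, next state)`. -/
noncomputable def walkWeight {S : Type*} [Fintype S] (a : ℕ → S → Bool × S → ℝ) :
    (m : ℕ) → ℕ → S → Bits m → ℝ
  | 0, _, _, _ => 1
  | m + 1, t, st, x => ∑ st', a t st (x 0, st') * walkWeight a m (t + 1) st' (Fin.tail x)

/-- The sign of a bit. -/
def bitSign (b : Bool) : ℝ := if b then 1 else -1

section BranchingPrograms

lemma bpRun_map_state {S S' : Type*} (e : S → S') (trans : ℕ → S → PMF (Bool × S))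
    (trans' : ℕ → S' → PMF (Bool × S'))
    (h : ∀ t st, trans' t (e st) = (trans t st).map (Prod.map id e)) (m t : ℕ) (st : S) :
    bpRun trans' t m (e st) = bpRun trans t m st := by
  induction m generalizing t st with
  | zero => rfl
  | succ m ih => simp [bpRun, h, PMF.bind_map, Function.comp_def, ih]

/-- The states of a space-`s` source may be taken to be `Fin (2 ^ s)`. -/
lemma IsSpaceSource.exists_fin {n s : ℕ} {p : PMF (Bits n)} (hp : IsSpaceSource s p) :
    ∃ (start : Fin (2 ^ s)) (trans : ℕ → Fin (2 ^ s) → PMF (Bool × Fin (2 ^ s))),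
      p = (bpRun trans 0 n start).map fun l => fun i : Fin n => l.getD i.val false := by
  obtain ⟨S, _, start, trans, hcard, rfl⟩ := hp
  have : Nonempty S := ⟨start⟩
  obtain ⟨e⟩ : Nonempty (S ↪ Fin (2 ^ s)) :=
    Function.Embedding.nonempty_of_card_le (by simpa using hcard)
  refine ⟨e start,
    fun t j => (trans t (Function.invFun e j)).map (Prod.map id e), ?_⟩
  rw [bpRun_map_state e trans]
  intro t st
  rw [Function.leftInverse_invFun e.injective]

lemma PMF.map_cons_apply {m : ℕ} (P : PMF (Bits m)) (b : Bool) (x : Bits (m + 1)) :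
    (P.map (fun y => (Fin.cons b y : Bits (m + 1)))) x
      = if x 0 = b then P (Fin.tail x) else 0 := by
  classical
  rw [PMF.map_apply, tsum_fintype]
  split_ifs with hb
  · rw [Finset.sum_eq_single (Fin.tail x)]
    · rw [if_pos]
      rw [← hb, Fin.cons_self_tail]
    · intro y _ hy
      rw [if_neg]
      rintro rfl
      simp at hy
    · simp
  · refine Finset.sum_eq_zero fun y _ => if_neg ?_
    rintro rfl
    simp at hb

lemma bpRun_toReal_eq_walkWeight {S : Type*} [Fintype S] (trans : ℕ → S → PMF (Bool × S))
    (m t : ℕ) (st : S) (x : Bits m) :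
    (((bpRun trans t m st).map fun l => fun i : Fin m => l.getD i.val false) x).toReal
      = walkWeight (fun t st z => (trans t st z).toReal) m t st x := by
  induction m generalizing t st with
  | zero =>
    simp only [bpRun, PMF.pure_map, walkWeight, PMF.pure_apply]
    rw [if_pos (Subsingleton.elim _ _), ENNReal.toReal_one]
  | succ m ih =>
    have hcons : ((bpRun trans t (m + 1) st).map fun l => fun i : Fin (m + 1) =>
        l.getD i.val false) = (trans t st).bind fun bs =>
          ((bpRun trans (t + 1) m bs.2).map fun l => fun i : Fin m => l.getD i.val false).map
            (fun y => (Fin.cons bs.1 y : Bits (m + 1))) := by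
      simp only [bpRun, PMF.map_bind, PMF.map_comp]
      congr 1
      funext bs
      congr 1
      funext l i
      refine Fin.cases ?_ (fun j => ?_) i <;> simp
    rw [hcons, PMF.bind_apply, tsum_fintype, walkWeight]
    simp only [PMF.map_cons_apply, ← ih]
    rw [Fintype.sum_prod_type, ENNReal.toReal_sum]
    · rw [Finset.sum_eq_single (x 0)]
      · rw [ENNReal.toReal_sum]
        · simp
        · intro z _
          refine ENNReal.mul_ne_top (PMF.apply_ne_top _ _) ?_
          rw [if_pos rfl]
          exact PMF.apply_ne_top _ _
      · intro b _ hb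
        simp [hb.symm]
      · simp
    · intro b _
      refine ENNReal.sum_ne_top.2 fun z _ => ?_
      refine ENNReal.mul_ne_top (PMF.apply_ne_top _ _) ?_
      split_ifs
      · exact PMF.apply_ne_top _ _
      · simp

end BranchingPrograms

section Weights

variable {S : Type*} [Fintype S] {a b : ℕ → S → Bool × S → ℝ} {n : ℕ}

lemma PMF.sum_toReal {α : Type*} [Fintype α] (p : PMF α) : ∑ x, (p x).toReal = 1 := by
  rw [← ENNReal.toReal_sum fun x _ => p.apply_ne_top x, ← tsum_fintype (L := .unconditional _),
    p.tsum_coe, ENNReal.toReal_one]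

lemma sum_walkWeight_succ (m t : ℕ) (st : S) :
    ∑ x, walkWeight a (m + 1) t st x
      = ∑ z, a t st z * ∑ x, walkWeight a m (t + 1) z.2 x := by
  rw [← (Fin.consEquiv fun _ : Fin (m + 1) => Bool).sum_comp, Fintype.sum_prod_type,
    Fintype.sum_prod_type]
  refine Finset.sum_congr rfl fun c _ => ?_
  have hx (y : Bits m) : walkWeight a (m + 1) t st ((Fin.consEquiv fun _ => Bool) (c, y))
      = ∑ st', a t st (c, st') * walkWeight a m (t + 1) st' y := rfl
  simp only [hx]
  rw [Finset.sum_comm]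
  simp only [Finset.mul_sum]

lemma walkWeight_nonneg (ha : ∀ t < n, ∀ st z, 0 ≤ a t st z) {m t : ℕ} (h : t + m ≤ n)
    (st : S) (x : Bits m) : 0 ≤ walkWeight a m t st x := by
  induction m generalizing t st with
  | zero => simp [walkWeight]
  | succ m ih =>
    exact Finset.sum_nonneg fun st' _ =>
      mul_nonneg (ha t (by omega) _ _) (ih (by omega) _ _)

lemma walkWeight_mono (hb : ∀ t < n, ∀ st z, 0 ≤ b t st z)
    (hba : ∀ t < n, ∀ st z, b t st z ≤ a t st z) {m t : ℕ} (h : t + m ≤ n)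
    (st : S) (x : Bits m) : walkWeight b m t st x ≤ walkWeight a m t st x := by
  induction m generalizing t st with
  | zero => simp [walkWeight]
  | succ m ih =>
    exact Finset.sum_le_sum fun st' _ => mul_le_mul (hba t (by omega) _ _) (ih (by omega) _ _)
      (walkWeight_nonneg hb (by omega) _ _)
      ((hb t (by omega) _ _).trans (hba t (by omega) _ _))

lemma sum_walkWeight (ha : ∀ t < n, ∀ st, ∑ z, a t st z = 1) {m t : ℕ} (h : t + m ≤ n)
    (st : S) : ∑ x, walkWeight a m t st x = 1 := by
  induction m generalizing t st with
  | zero => simp [walkWeight]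
  | succ m ih =>
    rw [sum_walkWeight_succ, ← ha t (by omega) st]
    exact Finset.sum_congr rfl fun z _ => by rw [ih (by omega), mul_one]

/-- Lowering every step weight by at most `δ` lowers the total weight by at most `2 |S| δ` per
step. -/
lemma sum_walkWeight_sub_le (ha : ∀ t < n, ∀ st, ∑ z, a t st z = 1)
    (hb : ∀ t < n, ∀ st z, 0 ≤ b t st z)
    (hba : ∀ t < n, ∀ st z, b t st z ≤ a t st z) {δ : ℝ} (hδ : 0 ≤ δ)
    (hab : ∀ t < n, ∀ st z, a t st z - b t st z ≤ δ) {m t : ℕ} (h : t + m ≤ n) (st : S) :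
    ∑ x, walkWeight a m t st x - ∑ x, walkWeight b m t st x
      ≤ m * (2 * Fintype.card S * δ) := by
  induction m generalizing t st with
  | zero => simp [walkWeight]
  | succ m ih =>
    have ht : t < n := by omega
    have hC : 0 ≤ m * (2 * Fintype.card S * δ) := by positivity
    rw [sum_walkWeight_succ, sum_walkWeight_succ, ← Finset.sum_sub_distrib]
    calc _ ≤ ∑ z, (δ + a t st z * (m * (2 * Fintype.card S * δ))) := by
          refine Finset.sum_le_sum fun z _ => ?_
          have h1 := ih (t := t + 1) (by omega) z.2
          rw [sum_walkWeight ha (by omega)] at h1 ⊢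
          nlinarith [mul_le_mul_of_nonneg_left h1 (hb t ht st z), hab t ht st z,
            mul_le_mul_of_nonneg_right (hba t ht st z) hC]
      _ = _ := by
          rw [Finset.sum_add_distrib, ← Finset.sum_mul, ha t ht]
          simp
          ring

end Weights

section Signs

lemma abs_bitSign (b : Bool) : |bitSign b| = 1 := by cases b <;> simp [bitSign]

/-- The moment generating function of a random signed sum is subgaussian. -/
lemma sum_exp_bitSign_le {α : Type*} [Fintype α] [DecidableEq α] (w : α → ℝ) {v : ℝ}
    (hv : ∑ x, w x ^ 2 ≤ v) (l : ℝ) :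
    ∑ f : α → Bool, Real.exp (l * ∑ x, bitSign (f x) * w x)
      ≤ Fintype.card (α → Bool) * Real.exp (l ^ 2 * v / 2) := by
  have hprod : ∀ f : α → Bool, Real.exp (l * ∑ x, bitSign (f x) * w x)
      = ∏ x, Real.exp (l * (bitSign (f x) * w x)) := fun f => by
    rw [Finset.mul_sum, Real.exp_sum]
  simp only [hprod]
  rw [← Fintype.piFinset_univ,
    ← Finset.prod_univ_sum (fun _ : α => (Finset.univ : Finset Bool))
      (fun x c => Real.exp (l * (bitSign c * w x)))]
  calc _ ≤ ∏ x, (2 * Real.exp ((l * w x) ^ 2 / 2)) := by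
        refine Finset.prod_le_prod (fun x _ => by positivity) fun x _ => ?_
        have := Real.cosh_le_exp_half_sq (l * w x)
        rw [Real.cosh_eq] at this
        simp [bitSign]
        linarith
    _ = Fintype.card (α → Bool) * Real.exp (l ^ 2 * (∑ x, w x ^ 2) / 2) := by
        rw [Finset.prod_mul_distrib, ← Real.exp_sum]
        simp [mul_pow, Finset.mul_sum, Finset.sum_div]
    _ ≤ _ := by gcongr

/-- Some sign pattern is nearly balanced against every vector of small `ℓ²` norm in a finite
family. -/
lemma exists_balanced_signs {α ι : Type*} [Fintype α] [Fintype ι] [Nonempty ι]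
    (w : ι → α → ℝ) {v l : ℝ} (hv : 0 ≤ v) (hl : 0 < l) :
    ∃ f : α → Bool, ∀ i, ∑ x, w i x ^ 2 ≤ v →
      |∑ x, bitSign (f x) * w i x| ≤ Real.log (2 * Fintype.card ι) / l + l * v / 2 := by
  classical
  let u : ι → α → ℝ := fun i => if ∑ x, w i x ^ 2 ≤ v then w i else 0
  have hu : ∀ i, ∑ x, u i x ^ 2 ≤ v := fun i => by
    by_cases h : ∑ x, w i x ^ 2 ≤ v <;> simp [u, h, hv]
  let B : ℝ := 2 * Fintype.card ι * Real.exp (l ^ 2 * v / 2)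
  obtain ⟨f, -, hf⟩ : ∃ f ∈ (Finset.univ : Finset (α → Bool)),
      ∑ i, (Real.exp (l * ∑ x, bitSign (f x) * u i x)
        + Real.exp (-l * ∑ x, bitSign (f x) * u i x)) ≤ B := by
    refine Finset.exists_le_of_sum_le Finset.univ_nonempty ?_
    rw [Finset.sum_comm]
    calc _ ≤ ∑ i : ι, (2 * (Fintype.card (α → Bool) * Real.exp (l ^ 2 * v / 2))) := by
          refine Finset.sum_le_sum fun i _ => ?_
          rw [Finset.sum_add_distrib]
          have h1 := sum_exp_bitSign_le (u i) (hu i) l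
          have h2 := sum_exp_bitSign_le (u i) (hu i) (-l)
          rw [neg_sq] at h2
          linarith
      _ = ∑ f : α → Bool, B := by
          simp only [Finset.sum_const, Finset.card_univ, nsmul_eq_mul, B]
          ring
  refine ⟨f, fun i hi => ?_⟩
  have hui : u i = w i := if_pos hi
  set y := ∑ x, bitSign (f x) * w i x with hy
  have hcard : (0 : ℝ) < Fintype.card ι := by exact_mod_cast Fintype.card_pos
  have hle : Real.exp (l * y) + Real.exp (-l * y) ≤ B := by
    refine le_trans ?_ hf
    rw [hy, ← hui]
    exact Finset.single_le_sum (f := fun i => Real.exp (l * ∑ x, bitSign (f x) * u i x)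
        + Real.exp (-l * ∑ x, bitSign (f x) * u i x))
      (fun j _ => by positivity) (Finset.mem_univ i)
  have hexp : Real.exp (l * |y|) ≤ B := by
    rcases abs_cases y with ⟨h, -⟩ | ⟨h, -⟩ <;> rw [h]
    · linarith [Real.exp_pos (-l * y)]
    · rw [mul_neg, ← neg_mul]
      linarith [Real.exp_pos (l * y)]
  have hlog := (Real.le_log_iff_exp_le (by positivity)).2 hexp
  rw [Real.log_mul (by positivity) (by positivity), Real.log_exp] at hlog
  rw [← mul_le_mul_iff_right₀ hl]
  calc l * |y| ≤ _ := hlog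
    _ = _ := by field_simp

/-- The distance of a bit from uniform is half its bias. -/
lemma sd_map_uniformBit_le {α : Type*} [Fintype α] (p : PMF α) (f : α → Bool) :
    sd (p.map f) uniformBit ≤ |∑ x, bitSign (f x) * (p x).toReal| / 2 := by
  classical
  have hmap : ∀ c, ((p.map f) c).toReal = ∑ x, if c = f x then (p x).toReal else 0 := fun c => by
    rw [PMF.map_apply, tsum_fintype, ENNReal.toReal_sum]
    · exact Finset.sum_congr rfl fun x _ => by split_ifs <;> simp
    · intro x _
      split_ifs <;> simp [PMF.apply_ne_top]
  have hbias : ∑ x, bitSign (f x) * (p x).toReal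
      = ((p.map f) true).toReal - ((p.map f) false).toReal := by
    rw [hmap, hmap, ← Finset.sum_sub_distrib]
    exact Finset.sum_congr rfl fun x _ => by cases f x <;> simp [bitSign]
  have hsum : ((p.map f) true).toReal + ((p.map f) false).toReal = 1 := by
    simpa using PMF.sum_toReal (p.map f)
  have hunif : ∀ c, (uniformBit c).toReal = 1 / 2 := fun c => by simp [uniformBit]
  rw [hbias]
  refine ciSup_le fun T => ?_
  simp only [hunif, ← Finset.sum_sub_distrib]
  have hT (g : Bool → ℝ) : ∑ c ∈ T, g c
      = (if true ∈ T then g true else 0) + if false ∈ T then g false else 0 := by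
    rw [← Fintype.sum_bool fun c => if c ∈ T then g c else 0, Finset.sum_ite_mem,
      Finset.univ_inter]
  rw [hT, eq_sub_of_add_eq' hsum]
  generalize ((p.map f) true).toReal = q
  rw [show q - (1 - q) = 2 * (q - 1 / 2) by ring, abs_mul, abs_two,
    mul_div_cancel_left₀ _ two_ne_zero]
  split_ifs
  · rw [show q - 1 / 2 + (1 - q - 1 / 2) = 0 by ring, abs_zero]
    exact abs_nonneg _
  · rw [add_zero]
  · rw [zero_add, show 1 - q - 1 / 2 = -(q - 1 / 2) by ring, abs_neg]
  · rw [add_zero, abs_zero]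
    exact abs_nonneg _

end Signs

section Counting

lemma le_length_of_minEntropyGe {n : ℕ} {p : PMF (Bits n)} {k : ℝ} (h : minEntropyGe p k) :
    k ≤ n := by
  have h1 : (1 : ℝ) ≤ 2 ^ ((n : ℝ) - k) := by
    calc (1 : ℝ) = ∑ x, (p x).toReal := p.sum_toReal.symm
      _ ≤ ∑ _x : Bits n, (2 : ℝ) ^ (-k) := Finset.sum_le_sum fun x _ => h x
      _ = 2 ^ ((n : ℝ) - k) := by
        rw [sub_eq_add_neg, Real.rpow_add two_pos]
        simp
  by_contra! hk
  exact absurd h1 (not_le.2 (Real.rpow_lt_one_of_one_lt_of_neg one_lt_two (by linarith)))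

/-- Step weights which are multiples of `1 / M`, set to zero from time `n` on. -/
noncomputable def gridWeight {S : Type*} {n M : ℕ} (g : Fin n → S → Bool × S → Fin (M + 1)) :
    ℕ → S → Bool × S → ℝ :=
  fun t st z => if h : t < n then ((g ⟨t, h⟩ st z : ℕ) : ℝ) / M else 0

/-- Transition probabilities can be rounded down to the grid. -/
lemma exists_gridWeight {S : Type*} (n : ℕ) {M : ℕ} (hM : 0 < M)
    (trans : ℕ → S → PMF (Bool × S)) :
    ∃ g : Fin n → S → Bool × S → Fin (M + 1), ∀ t < n, ∀ st z,
      gridWeight g t st z ≤ (trans t st z).toReal ∧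
        (trans t st z).toReal - gridWeight g t st z ≤ 1 / M := by
  have hM' : (0 : ℝ) < M := by exact_mod_cast hM
  have hle (t : ℕ) (st : S) (z : Bool × S) : ⌊M * (trans t st z).toReal⌋₊ < M + 1 := by
    refine Nat.lt_succ_of_le (Nat.floor_le_of_le ?_)
    refine mul_le_of_le_one_right hM'.le ?_
    exact ENNReal.toReal_le_of_le_ofReal zero_le_one (by simpa using PMF.coe_le_one _ _)
  refine ⟨fun t st z => ⟨_, hle t st z⟩, fun t ht st z => ?_⟩
  simp only [gridWeight, dif_pos ht]
  constructor
  · rw [div_le_iff₀ hM', mul_comm _ (M : ℝ)]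
    exact Nat.floor_le (by positivity)
  · rw [sub_le_iff_le_add, ← add_div, le_div_iff₀ hM', mul_comm _ (M : ℝ), add_comm]
    exact (Nat.lt_floor_add_one _).le

/-- A bound for the logarithm of the number of branching programs with weights on a grid. -/
lemma log_card_le {ε : ℝ} (hε : 0 < ε) {n s M D : ℕ} (hn : 2 ≤ n) (hs : s ≤ n)
    (hM : (M : ℝ) ≤ n * (2 * 2 ^ s) / ε + 1) (hD : (4 * (5 + 1 / ε) + 4) / ε ^ 2 ≤ D) :
    Real.log (2 * (2 ^ s * (((M + 1 : ℝ) ^ (2 * 2 ^ s)) ^ (2 ^ s)) ^ n))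
      ≤ ε ^ 2 * ((2 ^ s) ^ 2 * n ^ (2 + D)) / 2 := by
  set A : ℝ := 5 + 1 / ε with hA
  have hn' : (2 : ℝ) ≤ n := by exact_mod_cast hn
  have hs' : (s : ℝ) ≤ n := by exact_mod_cast hs
  have hl2 : Real.log 2 ≤ 1 := by linarith [Real.log_two_lt_d9]
  have hε' : 0 < 1 / ε := by positivity
  have h2s : (1 : ℝ) ≤ 2 ^ s := one_le_pow₀ one_le_two
  have hlogM : Real.log (M + 1) ≤ n * A := by
    have hle : (M + 1 : ℝ) ≤ 2 * n * 2 ^ s * (1 / ε + 2) := by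
      have : n * (2 * 2 ^ s) / ε = 2 * n * 2 ^ s * (1 / ε) := by ring
      have : (1 : ℝ) ≤ n * 2 ^ s := one_le_mul_of_one_le_of_one_le (by linarith) h2s
      nlinarith
    have hlog := Real.log_le_log (by positivity) hle
    rw [Real.log_mul (by positivity) (by positivity), Real.log_mul (by positivity) (by positivity),
      Real.log_mul (by positivity) (by positivity), Real.log_pow] at hlog
    have h1 : Real.log n ≤ n := Real.log_le_self (by positivity)
    have h2 : Real.log (1 / ε + 2) ≤ 1 / ε + 2 := Real.log_le_self (by positivity)
    have h3 : s * Real.log 2 ≤ n * 1 := by gcongr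
    nlinarith
  have hlog : Real.log (2 * (2 ^ s * (((M + 1 : ℝ) ^ (2 * 2 ^ s)) ^ (2 ^ s)) ^ n))
      = Real.log 2 + s * Real.log 2 + 2 * (2 ^ s) ^ 2 * n * Real.log (M + 1) := by
    rw [Real.log_mul (by positivity) (by positivity), Real.log_mul (by positivity) (by positivity)]
    simp only [Real.log_pow]
    push_cast
    ring
  have hpow : (4 * A + 4) / ε ^ 2 ≤ (n : ℝ) ^ D := by
    refine hD.trans ?_
    calc (D : ℝ) ≤ 2 ^ D := by exact_mod_cast Nat.lt_two_pow_self.le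
      _ ≤ _ := by gcongr
  rw [div_le_iff₀ (by positivity)] at hpow
  have hQ : (1 : ℝ) ≤ (2 ^ s) ^ 2 := one_le_pow₀ h2s
  rw [hlog]
  calc _ ≤ 1 + n * 1 + 2 * (2 ^ s) ^ 2 * n * (n * A) := by gcongr
    _ ≤ (2 ^ s) ^ 2 * n ^ 2 * (2 * A + 2) := by
      have : (1 : ℝ) * n ^ 2 ≤ (2 ^ s) ^ 2 * n ^ 2 := by gcongr
      nlinarith
    _ ≤ (2 ^ s) ^ 2 * n ^ 2 * (n ^ D * ε ^ 2 / 2) := by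
      gcongr
      linarith
    _ = _ := by ring

end Counting

/-- For every constant `ε > 0` there exists a constant `c > 1` such that for every
`s > 0` and every `n` there is a one-bit extractor for space-`s` sources on `n` bits
with min-entropy at least `2s + c log₂ n`, with error `ε`. -/
theorem stmt_3 :
    ∀ ε : ℝ, ε > 0 →
      ∃ c : ℝ, c > 1 ∧
        ∀ s : ℕ, 0 < s →
          ∀ n : ℕ, ∃ SpExt : Bits n → Bool,
            ∀ p : PMF (Bits n), IsSpaceSource s p →
              minEntropyGe p (2 * s + c * Real.logb 2 n) →
              sd (p.map SpExt) uniformBit ≤ ε := by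
  intro ε hε
  let D : ℕ := ⌈(4 * (5 + 1 / ε) + 4) / ε ^ 2⌉₊
  refine ⟨(2 + D : ℕ), by push_cast; linarith [(Nat.cast_nonneg D : (0 : ℝ) ≤ D)], ?_⟩
  intro s hs n
  by_cases hns : 2 ≤ n ∧ s ≤ n
  swap
  · refine ⟨fun _ => true, fun p _ hent => absurd (le_length_of_minEntropyGe hent) ?_⟩
    have hlog : 0 ≤ ((2 + D : ℕ) : ℝ) * Real.logb 2 n :=
      mul_nonneg (Nat.cast_nonneg _) (div_nonneg (Real.log_natCast_nonneg n) (by positivity))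
    have : (n : ℝ) < 2 * s := by
      have : n < 2 * s := by omega
      exact_mod_cast this
    linarith
  obtain ⟨hn, hsn⟩ := hns
  have hn' : (0 : ℝ) < n := by
    have : 0 < n := by omega
    exact_mod_cast this
  let M : ℕ := ⌈n * (2 * 2 ^ s) / ε⌉₊
  have hM : 0 < M := Nat.ceil_pos.2 (by positivity)
  have hM' : (0 : ℝ) < M := by exact_mod_cast hM
  have hMle : (M : ℝ) ≤ n * (2 * 2 ^ s) / ε + 1 := (Nat.ceil_lt_add_one (by positivity)).le
  let K : ℝ := (2 ^ s) ^ 2 * n ^ (2 + D)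
  have hK : 0 < K := by positivity
  have hpow : (2 : ℝ) ^ (-(2 * s + (2 + D : ℕ) * Real.logb 2 n)) = K⁻¹ := by
    rw [Real.rpow_neg two_pos.le, Real.rpow_add two_pos, mul_comm (2 : ℝ),
      mul_comm _ (Real.logb 2 n),
      Real.rpow_mul two_pos.le, Real.rpow_mul two_pos.le,
      Real.rpow_logb two_pos (by norm_num) hn', Real.rpow_natCast, Real.rpow_natCast,
      Real.rpow_two]
  let ι := Fin (2 ^ s) × (Fin n → Fin (2 ^ s) → Bool × Fin (2 ^ s) → Fin (M + 1))
  obtain ⟨f, hf⟩ := exists_balanced_signs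
    (fun (i : ι) x => walkWeight (gridWeight i.2) n 0 i.1 x) (v := K⁻¹) (l := ε * K)
    (by positivity) (by positivity)
  refine ⟨f, fun p hp hent => (sd_map_uniformBit_le p f).trans ?_⟩
  obtain ⟨start, trans, rfl⟩ := hp.exists_fin
  simp only [minEntropyGe, hpow, bpRun_toReal_eq_walkWeight] at hent ⊢
  obtain ⟨g, hg⟩ := exists_gridWeight n hM trans
  set a : ℕ → Fin (2 ^ s) → Bool × Fin (2 ^ s) → ℝ := fun t st z => (trans t st z).toReal
  have ha (t : ℕ) (_ : t < n) (st : Fin (2 ^ s)) : ∑ z, a t st z = 1 := (trans t st).sum_toReal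
  have hb (t : ℕ) (ht : t < n) (st : Fin (2 ^ s)) (z : Bool × Fin (2 ^ s)) :
      0 ≤ gridWeight g t st z := by
    rw [gridWeight, dif_pos ht]
    positivity
  have hba (t : ℕ) (ht : t < n) (st : Fin (2 ^ s)) (z : Bool × Fin (2 ^ s)) :
      gridWeight g t st z ≤ a t st z := (hg t ht st z).1
  have hn0 : 0 + n ≤ n := by omega
  have hmono := walkWeight_mono hb hba hn0 start
  have hnonneg := walkWeight_nonneg hb hn0 start
  have hsumb : ∑ x, walkWeight (gridWeight g) n 0 start x ≤ 1 := by
    rw [← sum_walkWeight ha hn0 start]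
    exact Finset.sum_le_sum fun x _ => hmono x
  have hdiff : ∑ x, walkWeight a n 0 start x - ∑ x, walkWeight (gridWeight g) n 0 start x ≤ ε := by
    refine (sum_walkWeight_sub_le ha hb hba (by positivity)
      (fun t ht st z => (hg t ht st z).2) hn0 start).trans ?_
    have hceil : n * (2 * 2 ^ s) / ε ≤ (M : ℝ) := Nat.le_ceil _
    rw [div_le_iff₀ hε] at hceil
    rw [Fintype.card_fin, mul_one_div, mul_div_assoc', div_le_iff₀ hM']
    push_cast
    linarith
  have hsq : ∑ x, walkWeight (gridWeight g) n 0 start x ^ 2 ≤ K⁻¹ := by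
    calc _ ≤ ∑ x, K⁻¹ * walkWeight (gridWeight g) n 0 start x :=
          Finset.sum_le_sum fun x _ => by
            rw [sq]
            exact mul_le_mul_of_nonneg_right ((hmono x).trans (hent x)) (hnonneg x)
      _ ≤ K⁻¹ := by
          rw [← Finset.mul_sum]
          exact mul_le_of_le_one_right (by positivity) hsumb
  have hbias := hf (start, g) hsq
  have hcard : Real.log (2 * Fintype.card ι) / (ε * K) ≤ ε / 2 := by
    have hlog := log_card_le hε hn hsn hMle (Nat.le_ceil _)
    rw [div_le_iff₀ (by positivity)]
    simp only [ι, Fintype.card_prod, Fintype.card_fun, Fintype.card_fin, Fintype.card_bool]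
    push_cast
    refine hlog.trans (le_of_eq ?_)
    simp only [K, D]
    ring
  have hhalf : ε * K * K⁻¹ / 2 = ε / 2 := by rw [mul_inv_cancel_right₀ hK.ne']
  have herr : |∑ x, bitSign (f x) * walkWeight a n 0 start x
      - ∑ x, bitSign (f x) * walkWeight (gridWeight g) n 0 start x| ≤ ε := by
    refine le_trans ?_ hdiff
    rw [← Finset.sum_sub_distrib, ← Finset.sum_sub_distrib]
    refine (Finset.abs_sum_le_sum_abs _ _).trans (Finset.sum_le_sum fun x _ => ?_)
    rw [← mul_sub, abs_mul, abs_bitSign, one_mul, abs_of_nonneg (sub_nonneg.2 (hmono x))]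
  have htri := abs_sub_abs_le_abs_sub (∑ x, bitSign (f x) * walkWeight a n 0 start x)
    (∑ x, bitSign (f x) * walkWeight (gridWeight g) n 0 start x)
  simp only at hbias
  linarith
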